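/- Let ε > 0 and let (μ_n)_{n∈ℕ} be a sequence in M with call functions R_n = R_{μ_n}, such that I := ⋂_{n∈ℕ} [Eμ_n − ε, Eμ_n + ε] is nonempty. Then there exists a peacock (ν_n)_{n∈ℕ} with W∞(μ_n, ν_n) ≤ ε for all n ∈ ℕ if and only if there exists m ∈ I such that for all N ∈ ℕ and all x₁,…,x_N ∈ ℝ one has Φ_N(x₁,…,x_N; m, ε) ≤ 0. In that case the peacock can be chosen with Eν_n = m for all n. -/

import Mathlib

open MeasureTheory Filter Set
open scoped ENNReal

/-- Call function `R_μ(x) = ∫ (y−x)⁺ μ(dy)`. -/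
noncomputable def callFn (μ : Measure ℝ) (x : ℝ) : ℝ := ∫ y, max (y - x) 0 ∂μ

/-- Mean `Eμ = ∫ y μ(dy)`. -/
noncomputable def meanM (μ : Measure ℝ) : ℝ := ∫ y, y ∂μ

/-- Distribution function `F_μ(x) = μ((−∞,x])`. -/
noncomputable def cdfM (μ : Measure ℝ) (x : ℝ) : ℝ := (μ (Set.Iic x)).toReal

/-- Membership in `M`: Borel probability measure on ℝ with finite first moment. -/
def MemM (μ : Measure ℝ) : Prop :=
  IsProbabilityMeasure μ ∧ Integrable (fun y => y) μ

/-- Convex order `μ ≤_c ν`. -/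
def ConvexOrder (μ ν : Measure ℝ) : Prop :=
  ∀ φ : ℝ → ℝ, ConvexOn ℝ Set.univ φ → Integrable φ μ → Integrable φ ν →
    ∫ y, φ y ∂μ ≤ ∫ y, φ y ∂ν

/-- Infinity Wasserstein distance via distribution functions, valued in `[0,∞]`,
with `inf ∅ = ∞`. -/
noncomputable def Winf (μ ν : Measure ℝ) : ℝ≥0∞ :=
  sInf (ENNReal.ofReal '' {ε : ℝ | 0 < ε ∧ ∀ x : ℝ,
    cdfM μ (x - ε) ≤ cdfM ν x ∧ cdfM ν x ≤ cdfM μ (x + ε)})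

/-- Membership in the closed ball `B^∞(μ,ε)` (within `M`). -/
def InBallWinf (μ : Measure ℝ) (ε : ℝ) (ν : Measure ℝ) : Prop :=
  MemM ν ∧ Winf μ ν ≤ ENNReal.ofReal ε

/-- `conv2 f g`: the largest convex function majorized by `min f g`, pointwise. -/
noncomputable def conv2 (f g : ℝ → ℝ) (x : ℝ) : ℝ :=
  sSup {z : ℝ | ∃ h : ℝ → ℝ, ConvexOn ℝ Set.univ h ∧ (∀ y, h y ≤ min (f y) (g y)) ∧ z = h x}

/-- `R^min_μ(x; m, ε)`. -/
noncomputable def RminW (μ : Measure ℝ) (m ε x : ℝ) : ℝ :=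
  max (m + callFn μ (x - ε) - (meanM μ + ε)) (callFn μ (x + ε))

/-- `R^max_μ(x; m, ε)`. -/
noncomputable def RmaxW (μ : Measure ℝ) (m ε x : ℝ) : ℝ :=
  conv2 (fun y => m + callFn μ (y + ε) - (meanM μ - ε)) (fun y => callFn μ (y - ε)) x

/-- Right derivative. -/
noncomputable def rderiv (f : ℝ → ℝ) (x : ℝ) : ℝ := derivWithin f (Set.Ioi x) x

/-- `R` is a call function: convex, nonincreasing, tending to `0` at `+∞`, and
`R(x)+x` has a finite limit at `−∞`. -/
def IsCallFn (R : ℝ → ℝ) : Prop :=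
  ConvexOn ℝ Set.univ R ∧ Antitone R ∧
    Tendsto R atTop (nhds 0) ∧ ∃ c : ℝ, Tendsto (fun x => R x + x) atBot (nhds c)

/-- Stop-loss distance, valued in `[0,∞]`. -/
noncomputable def dSL (μ ν : Measure ℝ) : ℝ≥0∞ :=
  ⨆ x : ℝ, ENNReal.ofReal |callFn μ x - callFn ν x|

/-- Lévy distance. -/
noncomputable def dLevy (μ ν : Measure ℝ) : ℝ≥0∞ :=
  sInf (ENNReal.ofReal '' {h : ℝ | 0 < h ∧ ∀ x : ℝ,
    cdfM μ (x - h) - h ≤ cdfM ν x ∧ cdfM ν x ≤ cdfM μ (x + h) + h})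

/-- Prokhorov distance on ℝ. -/
noncomputable def dProk (μ ν : Measure ℝ) : ℝ≥0∞ :=
  sInf (ENNReal.ofReal '' {h : ℝ | 0 < h ∧ ∀ A : Set ℝ, IsClosed A →
    ν A ≤ μ (Metric.cthickening h A) + ENNReal.ofReal h})

/-- Modified Lévy distance with parameter `p`. -/
noncomputable def dLevyMod (p : ℝ) (μ ν : Measure ℝ) : ℝ≥0∞ :=
  sInf (ENNReal.ofReal '' {h : ℝ | 0 < h ∧ ∀ x : ℝ,
    cdfM μ (x - h) - p ≤ cdfM ν x ∧ cdfM ν x ≤ cdfM μ (x + h) + p})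

/-- Modified Prokhorov distance with parameter `p`. -/
noncomputable def dProkMod (p : ℝ) (μ ν : Measure ℝ) : ℝ≥0∞ :=
  sInf (ENNReal.ofReal '' {h : ℝ | 0 < h ∧ ∀ A : Set ℝ, IsClosed A →
    ν A ≤ μ (Metric.cthickening h A) + ENNReal.ofReal p})
/-- `Φ_N(x₁,…,x_N; m, ε)` from the paper, written with 0-based indices:
measures `μ 0, …, μ N`, points `x 0, …, x (N-1)`, `σ_n = sgn(x_{n−1} − x_n)`. -/
noncomputable def PhiW (μ : ℕ → Measure ℝ) (m ε : ℝ) (N : ℕ) (x : ℕ → ℝ) : ℝ :=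
  RminW (μ 0) m ε (x 0)
    + ∑ n ∈ Finset.Ico 1 N,
        (callFn (μ n) (x n + ε * Real.sign (x (n - 1) - x n))
          - callFn (μ n) (x (n - 1) + ε * Real.sign (x (n - 1) - x n)))
    - RmaxW (μ N) m ε (x (N - 1))

section PartA

lemma call_integrable {ν : Measure ℝ} (h : MemM ν) (x : ℝ) :
    Integrable (fun y => max (y - x) 0) ν := by
  have := h.1
  exact (h.2.sub (integrable_const x)).pos_part

lemma callFn_nonneg (ν : Measure ℝ) (x : ℝ) : 0 ≤ callFn ν x :=
  integral_nonneg (fun _ => le_max_right _ _)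

lemma callFn_convex {ν : Measure ℝ} (h : MemM ν) : ConvexOn ℝ Set.univ (callFn ν) := by
  refine ⟨convex_univ, ?_⟩
  intro x _ y _ a b ha hb hab
  have h1 : ∫ z, (a * max (z - x) 0 + b * max (z - y) 0) ∂ν = a * callFn ν x + b * callFn ν y := by
    rw [integral_add ((call_integrable h x).const_mul a) ((call_integrable h y).const_mul b),
      integral_const_mul, integral_const_mul]
    rfl
  simp only [smul_eq_mul]
  rw [← h1]
  refine integral_mono (call_integrable h _) (((call_integrable h x).const_mul a).add
    ((call_integrable h y).const_mul b)) ?_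
  intro z
  have e1 : a * (z - x) ≤ a * max (z - x) 0 := mul_le_mul_of_nonneg_left (le_max_left _ _) ha
  have e2 : b * (z - y) ≤ b * max (z - y) 0 := mul_le_mul_of_nonneg_left (le_max_left _ _) hb
  have e3 : 0 ≤ a * max (z - x) 0 := mul_nonneg ha (le_max_right _ _)
  have e4 : 0 ≤ b * max (z - y) 0 := mul_nonneg hb (le_max_right _ _)
  have e5 : a * (z - x) + b * (z - y) = z - (a * x + b * y) := by
    have : z = (a + b) * z := by rw [hab, one_mul]
    nth_rewrite 3 [this]
    ring
  show max (z - (a * x + b * y)) 0 ≤ a * max (z - x) 0 + b * max (z - y) 0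
  refine max_le ?_ ?_ <;> linarith

lemma cdfM_mono {ν : Measure ℝ} (h : MemM ν) : Monotone (cdfM ν) := by
  have := h.1
  intro x y hxy
  exact ENNReal.toReal_mono (measure_ne_top _ _) (measure_mono (Iic_subset_Iic.2 hxy))

lemma cdfM_eq {ν : Measure ℝ} (h : MemM ν) : cdfM ν = ⇑(ProbabilityTheory.cdf ν) := by
  have := h.1
  funext x
  rw [ProbabilityTheory.cdf_eq_real]; rfl

lemma cdfM_right {ν : Measure ℝ} (h : MemM ν) (x : ℝ) :
    Tendsto (cdfM ν) (nhdsWithin x (Ioi x)) (nhds (cdfM ν x)) := by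
  rw [cdfM_eq h]
  exact ((ProbabilityTheory.cdf ν).right_continuous x).tendsto.mono_left
    (nhdsWithin_mono _ Ioi_subset_Ici_self)

lemma meas_Ioi {ν : Measure ℝ} [IsProbabilityMeasure ν] (t : ℝ) :
    ν.real (Ioi t) = 1 - cdfM ν t := by
  have := prob_compl_eq_one_sub (μ := ν) (measurableSet_Iic (a := t))
  rw [compl_Iic] at this
  rw [measureReal_def, this, ENNReal.toReal_sub_of_le prob_le_one ENNReal.one_ne_top]
  rfl

lemma call_kernel (x y z : ℝ) (hxy : x ≤ y) :
    ∫ t in Ioc x y, (Iio z).indicator (fun _ => (1 : ℝ)) t = max (z - x) 0 - max (z - y) 0 := by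
  rw [setIntegral_indicator measurableSet_Iio, setIntegral_const, smul_eq_mul, mul_one]
  rcases le_or_gt z x with hz | hz
  · have : Ioc x y ∩ Iio z = ∅ := by
      ext t; simp; intro h1 h2; linarith
    rw [this, max_eq_right (by linarith), max_eq_right (by linarith)]; simp
  · rcases le_or_gt z y with hy | hy
    · have : Ioc x y ∩ Iio z = Ioo x z := by
        ext t; constructor
        · rintro ⟨⟨a, b⟩, c⟩; exact ⟨a, c⟩
        · rintro ⟨a, b⟩; exact ⟨⟨a, by linarith⟩, b⟩
      rw [this, max_eq_left (by linarith), max_eq_right (by linarith), Real.volume_real_Ioo_of_le hz.le]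
      ring
    · have : Ioc x y ∩ Iio z = Ioc x y := by
        ext t; simp; intro h1 h2; linarith
      rw [this, max_eq_left (by linarith), max_eq_left (by linarith), Real.volume_real_Ioc_of_le hxy]
      ring

lemma call_sub {ν : Measure ℝ} (h : MemM ν) {x y : ℝ} (hxy : x ≤ y) :
    callFn ν x - callFn ν y = ∫ t in Ioc x y, (1 - cdfM ν t) := by
  have := h.1
  unfold callFn
  rw [← integral_sub (call_integrable h x) (call_integrable h y)]
  simp_rw [← call_kernel x y _ hxy]
  have hm : MeasurableSet {p : ℝ × ℝ | p.2 < p.1} := measurableSet_lt measurable_snd measurable_fst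
  rw [integral_integral_swap]
  · refine integral_congr_ae (ae_of_all _ fun t => ?_)
    have : (fun z : ℝ => (Iio z).indicator (fun _ => (1 : ℝ)) t)
        = (Ioi t).indicator (fun _ => (1 : ℝ)) := by
      funext z; simp [indicator]
    simp only [this]
    rw [integral_indicator measurableSet_Ioi, setIntegral_const, smul_eq_mul, mul_one, meas_Ioi]
  · have : (Function.uncurry fun z t : ℝ => (Iio z).indicator (fun _ => (1 : ℝ)) t)
        = {p : ℝ × ℝ | p.2 < p.1}.indicator (fun _ => (1 : ℝ)) := by
      funext p; simp [indicator, Function.uncurry]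
    rw [this]
    exact (integrable_const (1 : ℝ)).indicator hm

lemma call_tendsto_top {ν : Measure ℝ} (h : MemM ν) : Tendsto (callFn ν) atTop (nhds 0) := by
  have := h.1
  have : Tendsto (fun x => ∫ y, max (y - x) 0 ∂ν) atTop (nhds (∫ _y, (0 : ℝ) ∂ν)) := by
    refine tendsto_integral_filter_of_dominated_convergence (fun y => |y|) ?_ ?_ h.2.abs ?_
    · exact Eventually.of_forall fun x => (call_integrable h x).aestronglyMeasurable
    · filter_upwards [eventually_ge_atTop (0 : ℝ)] with x hx
      refine ae_of_all _ fun y => ?_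
      rw [Real.norm_of_nonneg (le_max_right _ _)]
      exact max_le (by linarith [le_abs_self y]) (abs_nonneg _)
    · refine ae_of_all _ fun y => ?_
      refine tendsto_const_nhds.congr' ?_
      filter_upwards [eventually_ge_atTop y] with x hx
      rw [max_eq_right (by linarith)]
  rw [integral_zero] at this
  exact this

lemma call_add {ν : Measure ℝ} (h : MemM ν) (x : ℝ) :
    callFn ν x + x = ∫ y, max y x ∂ν := by
  have := h.1
  have : ∫ _y, x ∂ν = x := by simp
  nth_rewrite 2 [← this]
  unfold callFn
  rw [← integral_add (call_integrable h x) (integrable_const x)]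
  refine integral_congr_ae (ae_of_all _ fun y => ?_)
  simp only
  rw [max_add]; simp

lemma call_tendsto_bot {ν : Measure ℝ} (h : MemM ν) :
    Tendsto (fun x => callFn ν x + x) atBot (nhds (meanM ν)) := by
  have := h.1
  simp_rw [call_add h]
  refine tendsto_integral_filter_of_dominated_convergence (fun y => |y|) ?_ ?_ h.2.abs ?_
  · exact Eventually.of_forall fun x => (h.2.sup (integrable_const x)).aestronglyMeasurable
  · filter_upwards [eventually_le_atBot (0 : ℝ)] with x hx
    refine ae_of_all _ fun y => ?_
    rw [Real.norm_eq_abs]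
    rcases le_total y x with hh | hh
    · rw [max_eq_right hh, abs_of_nonpos hx, abs_of_nonpos (by linarith)]; linarith
    · rw [max_eq_left hh]
  · refine ae_of_all _ fun y => ?_
    refine tendsto_const_nhds.congr' ?_
    filter_upwards [eventually_le_atBot y] with x hx
    rw [max_eq_left hx]

lemma integrable_of_cdf {μ ν : Measure ℝ} (h : MemM μ) [IsProbabilityMeasure ν] (ε : ℝ)
    (hc : ∀ x : ℝ, cdfM μ (x - ε) ≤ cdfM ν x ∧ cdfM ν x ≤ cdfM μ (x + ε)) :
    Integrable (fun y => y) ν := by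
  have := h.1
  have hp : Integrable (fun y : ℝ => max (y + ε) 0) μ := (h.2.add (integrable_const ε)).pos_part
  have hn : Integrable (fun y : ℝ => max (-y + ε) 0) μ := (h.2.neg.add (integrable_const ε)).pos_part
  have key : ∀ (f g : ℝ → ℝ), Measurable f → (∀ y, 0 ≤ f y) → (∀ y, 0 ≤ g y) → Integrable g μ →
      ∫⁻ y, ENNReal.ofReal (f y) ∂ν ≤ ∫⁻ y, ENNReal.ofReal (g y) ∂μ → Integrable f ν := by
    intro f g hf f0 g0 hg hle
    refine ⟨hf.aestronglyMeasurable, ?_⟩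
    rw [hasFiniteIntegral_iff_ofReal (ae_of_all _ f0)]
    refine lt_of_le_of_lt hle ?_
    rw [← hasFiniteIntegral_iff_ofReal (ae_of_all _ g0)]
    exact hg.2
  have h1 : Integrable (fun y : ℝ => max y 0) ν := by
    refine key _ _ (by fun_prop) (fun _ => le_max_right _ _) (fun _ => le_max_right _ _) hp ?_
    rw [lintegral_eq_lintegral_meas_lt (f := fun y : ℝ => max y 0) ν
        (ae_of_all _ fun _ => le_max_right _ _) (by fun_prop),
      lintegral_eq_lintegral_meas_lt (f := fun y : ℝ => max (y + ε) 0) μ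
        (ae_of_all _ fun _ => le_max_right _ _) (by fun_prop)]
    refine setLIntegral_mono' measurableSet_Ioi fun t ht => ?_
    have e1 : {a : ℝ | t < max a 0} = Ioi t := by
      ext a; have := (mem_Ioi.1 ht).not_gt; simp [this]
    have e2 : {a : ℝ | t < max (a + ε) 0} = Ioi (t - ε) := by
      ext a; have := (mem_Ioi.1 ht).not_gt; simp [this, sub_lt_iff_lt_add]
    rw [e1, e2]
    have := (hc t).1
    rw [← ENNReal.toReal_le_toReal (measure_ne_top _ _) (measure_ne_top _ _)]
    have a1 := meas_Ioi (ν := ν) t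
    have a2 := meas_Ioi (ν := μ) (t - ε)
    rw [measureReal_def] at a1 a2
    rw [a1, a2]; linarith
  have h2 : Integrable (fun y : ℝ => max (-y) 0) ν := by
    refine key _ _ (by fun_prop) (fun _ => le_max_right _ _) (fun _ => le_max_right _ _) hn ?_
    rw [lintegral_eq_lintegral_meas_le (f := fun y : ℝ => max (-y) 0) ν
        (ae_of_all _ fun _ => le_max_right _ _) (by fun_prop),
      lintegral_eq_lintegral_meas_le (f := fun y : ℝ => max (-y + ε) 0) μ
        (ae_of_all _ fun _ => le_max_right _ _) (by fun_prop)]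
    refine setLIntegral_mono' measurableSet_Ioi fun t ht => ?_
    have e1 : {a : ℝ | t ≤ max (-a) 0} = Iic (-t) := by
      ext a; have := (mem_Ioi.1 ht).not_ge; simp [this]; exact le_neg
    have e2 : {a : ℝ | t ≤ max (-a + ε) 0} = Iic (-t + ε) := by
      ext a; have := (mem_Ioi.1 ht).not_ge; simp [this]
      constructor <;> intro <;> linarith
    rw [e1, e2]
    rw [← ENNReal.toReal_le_toReal (measure_ne_top _ _) (measure_ne_top _ _)]
    exact (hc (-t)).2
  refine (h1.sub h2).congr (ae_of_all _ fun y => ?_)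
  simp only [Pi.sub_apply]
  rcases le_total y 0 with hy | hy
  · rw [max_eq_right hy, max_eq_left (by linarith)]; ring
  · rw [max_eq_left hy, max_eq_right (by linarith)]; ring

lemma cdf_of_winf {μ ν : Measure ℝ} (h : MemM μ) (h' : MemM ν) {ε : ℝ} (hε : 0 < ε)
    (hw : Winf μ ν ≤ ENNReal.ofReal ε) :
    ∀ x : ℝ, cdfM μ (x - ε) ≤ cdfM ν x ∧ cdfM ν x ≤ cdfM μ (x + ε) := by
  have key : ∀ δ, ε < δ → ∀ x : ℝ, cdfM μ (x - δ) ≤ cdfM ν x ∧ cdfM ν x ≤ cdfM μ (x + δ) := by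
    intro δ hδ x
    have hlt : Winf μ ν < ENNReal.ofReal δ :=
      lt_of_le_of_lt hw ((ENNReal.ofReal_lt_ofReal_iff (by linarith)).2 hδ)
    obtain ⟨_, ⟨η, ⟨hη, hc⟩, rfl⟩, hlt'⟩ := sInf_lt_iff.1 hlt
    have hηδ : η < δ := (ENNReal.ofReal_lt_ofReal_iff (by linarith)).1 hlt'
    exact ⟨(cdfM_mono h (by linarith)).trans (hc x).1, (hc x).2.trans (cdfM_mono h (by linarith))⟩
  intro x
  constructor
  · refine ge_of_tendsto (cdfM_right h' x) ?_
    filter_upwards [self_mem_nhdsWithin] with y hy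
    have hy : x < y := hy
    have := (key (ε + (y - x)) (by linarith) y).1
    rwa [show y - (ε + (y - x)) = x - ε by ring] at this
  · refine ge_of_tendsto (cdfM_right h (x + ε)) ?_
    filter_upwards [self_mem_nhdsWithin] with y hy
    have hy : x + ε < y := hy
    have := (key (y - x) (by linarith) x).2
    rwa [show x + (y - x) = y by ring] at this

lemma winf_of_cdf {μ ν : Measure ℝ} {ε : ℝ} (hε : 0 < ε)
    (hc : ∀ x : ℝ, cdfM μ (x - ε) ≤ cdfM ν x ∧ cdfM ν x ≤ cdfM μ (x + ε)) :
    Winf μ ν ≤ ENNReal.ofReal ε :=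
  sInf_le ⟨ε, ⟨hε, hc⟩, rfl⟩

lemma cdf_intOn {ν : Measure ℝ} (h : MemM ν) (c x y : ℝ) :
    IntegrableOn (fun t => 1 - cdfM ν (t + c)) (Ioc x y) := by
  have hm : Monotone (fun t => cdfM ν (t + c)) := fun a b hab => cdfM_mono h (by linarith)
  have := (hm.intervalIntegrable (μ := volume) (a := x) (b := y)).1
  exact (integrableOn_const (by simp)).sub this

lemma call_sub_shift {ν : Measure ℝ} (h : MemM ν) (c : ℝ) {x y : ℝ} (hxy : x ≤ y) :
    callFn ν (x + c) - callFn ν (y + c) = ∫ t in Ioc x y, (1 - cdfM ν (t + c)) := by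
  rw [call_sub h (by linarith : x + c ≤ y + c), ← intervalIntegral.integral_of_le (by linarith),
    ← intervalIntegral.integral_of_le hxy,
    intervalIntegral.integral_comp_add_right (fun t => 1 - cdfM ν t)]

/-- Increment constraints from cdf constraints. -/
lemma incr_of_cdf {μ ν : Measure ℝ} (h : MemM μ) (h' : MemM ν) {ε : ℝ}
    (hc : ∀ x : ℝ, cdfM μ (x - ε) ≤ cdfM ν x ∧ cdfM ν x ≤ cdfM μ (x + ε))
    {x y : ℝ} (hxy : x ≤ y) :
    callFn μ (y - ε) - callFn μ (x - ε) ≤ callFn ν y - callFn ν x ∧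
    callFn ν y - callFn ν x ≤ callFn μ (y + ε) - callFn μ (x + ε) := by
  have e0 := call_sub_shift h' 0 hxy
  have e1 := call_sub_shift h ε hxy
  have e2 := call_sub_shift h (-ε) hxy
  simp only [add_zero, ← sub_eq_add_neg] at e0 e1 e2
  have i0 := cdf_intOn h' 0 x y
  have i1 := cdf_intOn h ε x y
  have i2 := cdf_intOn h (-ε) x y
  simp only [add_zero, ← sub_eq_add_neg] at i0 i1 i2
  have a1 := setIntegral_mono i0 i2 (fun t => by have := (hc t).1; simp only; linarith)
  have a2 := setIntegral_mono i1 i0 (fun t => by have := (hc t).2; simp only; linarith)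
  constructor <;> linarith

end PartA
section PartB

lemma rd_mono {G : ℝ → ℝ} (hG : ConvexOn ℝ Set.univ G) :
    Monotone (fun x => derivWithin G (Ioi x) x) := by
  have := hG.monotoneOn_rightDeriv
  rw [interior_univ] at this
  exact monotoneOn_univ.1 this

/-- right derivative as a Stieltjes function -/
noncomputable def rdS {G : ℝ → ℝ} (hG : ConvexOn ℝ Set.univ G) : StieltjesFunction ℝ :=
  (rd_mono hG).stieltjesFunction

lemma rdS_ae {G : ℝ → ℝ} (hG : ConvexOn ℝ Set.univ G) :
    ∀ᵐ t, rdS hG t = derivWithin G (Ioi t) t := by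
  have hc := (rd_mono hG).countable_not_continuousAt
  have h0 := hc.measure_zero volume
  rw [ae_iff]
  refine measure_mono_null ?_ h0
  intro t ht hcont
  apply ht
  have : ContinuousWithinAt (fun x => derivWithin G (Ioi x) x) (Ioi t) t :=
    ContinuousAt.continuousWithinAt hcont
  exact (rd_mono hG).continuousWithinAt_Ioi_iff_rightLim_eq.1 this

lemma rdS_ftc {G : ℝ → ℝ} (hG : ConvexOn ℝ Set.univ G) {x y : ℝ} (hxy : x ≤ y) :
    ∫ t in Ioc x y, rdS hG t = G y - G x := by
  rw [integral_congr_ae (ae_restrict_of_ae (rdS_ae hG)), ← intervalIntegral.integral_of_le hxy]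
  refine intervalIntegral.integral_eq_sub_of_hasDeriv_right ?_ ?_ ?_
  · exact (hG.continuousOn isOpen_univ).mono (subset_univ _)
  · intro t _
    exact hG.hasDerivWithinAt_rightDeriv_of_mem_interior (by simp)
  · exact (rd_mono hG).intervalIntegrable

lemma rdS_intOn {G : ℝ → ℝ} (hG : ConvexOn ℝ Set.univ G) (x y : ℝ) :
    IntegrableOn (rdS hG) (Ioc x y) :=
  ((rdS hG).mono.intervalIntegrable (μ := volume) (a := x) (b := y)).1

noncomputable def wker (x k : ℝ) : ℝ≥0∞ :=
  if 0 < k then ENNReal.ofReal (x - k) else ENNReal.ofReal (k - x)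

lemma wker_meas : Measurable (Function.uncurry wker) := by
  unfold Function.uncurry wker
  refine Measurable.ite (measurableSet_lt measurable_const measurable_snd) ?_ ?_ <;> fun_prop

lemma ker_pos {x : ℝ} (hx : 0 ≤ x) (k : ℝ) :
    ∫⁻ t in Ioc 0 x, (Ioc 0 t).indicator (fun _ => (1 : ℝ≥0∞)) k = wker x k := by
  unfold wker
  by_cases hk : 0 < k
  · rw [if_pos hk]
    have : (fun t : ℝ => (Ioc 0 t).indicator (fun _ => (1 : ℝ≥0∞)) k)
      = (Ici k).indicator (fun _ => (1 : ℝ≥0∞)) := by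
      funext t; simp [indicator, hk]
    rw [this, lintegral_indicator measurableSet_Ici, setLIntegral_const, one_mul,
      Measure.restrict_apply measurableSet_Ici]
    have : Ici k ∩ Ioc 0 x = Icc k x := by
      ext t; constructor
      · rintro ⟨a, b, c⟩; exact ⟨a, c⟩
      · rintro ⟨a, b⟩; exact ⟨a, lt_of_lt_of_le hk a, b⟩
    rw [this, Real.volume_Icc]
  · rw [if_neg hk, ENNReal.ofReal_of_nonpos (by linarith)]
    simp [indicator, hk]

lemma ker_neg {x : ℝ} (hx : x ≤ 0) (k : ℝ) :
    ∫⁻ t in Ioc x 0, (Ioc t 0).indicator (fun _ => (1 : ℝ≥0∞)) k = wker x k := by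
  unfold wker
  by_cases hk : 0 < k
  · rw [if_pos hk, ENNReal.ofReal_of_nonpos (by linarith)]
    simp [indicator, hk.not_ge]
  · rw [if_neg hk]
    have hk' : k ≤ 0 := not_lt.1 hk
    have : (fun t : ℝ => (Ioc t 0).indicator (fun _ => (1 : ℝ≥0∞)) k)
      = (Iio k).indicator (fun _ => (1 : ℝ≥0∞)) := by
      funext t; simp [indicator, hk']
    rw [this, lintegral_indicator measurableSet_Iio, setLIntegral_const, one_mul,
      Measure.restrict_apply measurableSet_Iio]
    have : Iio k ∩ Ioc x 0 = Ioo x k := by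
      ext t; constructor
      · rintro ⟨a, b, c⟩; exact ⟨b, a⟩
      · rintro ⟨a, b⟩; exact ⟨b, a, b.le.trans hk'⟩
    rw [this, Real.volume_Ioo]

lemma taylor_aux {φ : ℝ → ℝ} (hφ : ConvexOn ℝ Set.univ φ) (x : ℝ) :
    0 ≤ φ x - φ 0 - rdS hφ 0 * x ∧
    ENNReal.ofReal (φ x - φ 0 - rdS hφ 0 * x) = ∫⁻ k, wker x k ∂(rdS hφ).measure := by
  set S := rdS hφ with hS
  have swap : ∀ (A : Set ℝ) (B : Set (ℝ × ℝ)), MeasurableSet B →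
      ∫⁻ t in A, ∫⁻ k, B.indicator (fun _ => (1 : ℝ≥0∞)) (t, k) ∂S.measure
      = ∫⁻ k, ∫⁻ t in A, B.indicator (fun _ => (1 : ℝ≥0∞)) (t, k) ∂volume ∂S.measure := by
    intro A B hB
    rw [lintegral_lintegral_swap]
    exact (measurable_const.indicator hB).aemeasurable
  have i1 : ∀ a b : ℝ, Integrable (fun t => S t) (volume.restrict (Ioc a b)) := rdS_intOn hφ
  have i2 : ∀ a b : ℝ, Integrable (fun _ : ℝ => S 0) (volume.restrict (Ioc a b)) :=
    fun a b => integrable_const _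
  have i3 : ∀ a b : ℝ, Integrable (fun t => S t - S 0) (volume.restrict (Ioc a b)) :=
    fun a b => (i1 a b).sub (i2 a b)
  have i4 : ∀ a b : ℝ, Integrable (fun t => S 0 - S t) (volume.restrict (Ioc a b)) :=
    fun a b => (i2 a b).sub (i1 a b)
  rcases le_total 0 x with hx | hx
  · have e : φ x - φ 0 - S 0 * x = ∫ t in Ioc 0 x, (S t - S 0) := by
      rw [integral_sub (i1 0 x) (i2 0 x), rdS_ftc hφ hx,
        setIntegral_const, Real.volume_real_Ioc_of_le hx]
      simp; ring
    have nn : 0 ≤ᵐ[volume.restrict (Ioc 0 x)] fun t => S t - S 0 := by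
      filter_upwards [ae_restrict_mem measurableSet_Ioc] with t ht
      have := S.mono ht.1.le
      simp only [Pi.zero_apply]; linarith
    refine ⟨by rw [e]; exact integral_nonneg_of_ae nn, ?_⟩
    rw [e, ofReal_integral_eq_lintegral_ofReal
      (i3 0 x) nn]
    simp_rw [← ker_pos hx]
    have hB : MeasurableSet {p : ℝ × ℝ | 0 < p.2 ∧ p.2 ≤ p.1} :=
      (measurableSet_lt measurable_const measurable_snd).inter
        (measurableSet_le measurable_snd measurable_fst)
    have hsw := swap (Ioc 0 x) _ hB
    have e3 : ∀ t k : ℝ, {p : ℝ × ℝ | 0 < p.2 ∧ p.2 ≤ p.1}.indicator (fun _ => (1 : ℝ≥0∞)) (t, k)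
        = (Ioc 0 t).indicator (fun _ => (1 : ℝ≥0∞)) k := by
      intro t k; simp [indicator]
    simp_rw [e3] at hsw
    rw [← hsw]
    refine lintegral_congr fun t => ?_
    rw [lintegral_indicator measurableSet_Ioc, setLIntegral_const, one_mul, S.measure_Ioc]
  · have e : φ x - φ 0 - S 0 * x = ∫ t in Ioc x 0, (S 0 - S t) := by
      rw [integral_sub (i2 x 0) (i1 x 0), rdS_ftc hφ hx,
        setIntegral_const, Real.volume_real_Ioc_of_le hx]
      simp; ring
    have nn : 0 ≤ᵐ[volume.restrict (Ioc x 0)] fun t => S 0 - S t := by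
      filter_upwards [ae_restrict_mem measurableSet_Ioc] with t ht
      have := S.mono ht.2
      simp only [Pi.zero_apply]; linarith
    refine ⟨by rw [e]; exact integral_nonneg_of_ae nn, ?_⟩
    rw [e, ofReal_integral_eq_lintegral_ofReal
      (i4 x 0) nn]
    simp_rw [← ker_neg hx]
    have hB : MeasurableSet {p : ℝ × ℝ | p.1 < p.2 ∧ p.2 ≤ 0} :=
      (measurableSet_lt measurable_fst measurable_snd).inter
        (measurableSet_le measurable_snd measurable_const)
    have hsw := swap (Ioc x 0) _ hB
    have e3 : ∀ t k : ℝ, {p : ℝ × ℝ | p.1 < p.2 ∧ p.2 ≤ 0}.indicator (fun _ => (1 : ℝ≥0∞)) (t, k)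
        = (Ioc t 0).indicator (fun _ => (1 : ℝ≥0∞)) k := by
      intro t k; simp [indicator]
    simp_rw [e3] at hsw
    rw [← hsw]
    refine lintegral_congr fun t => ?_
    rw [lintegral_indicator measurableSet_Ioc, setLIntegral_const, one_mul, S.measure_Ioc]

lemma put_eq {ν : Measure ℝ} (h : MemM ν) (k : ℝ) :
    ∫ y, max (k - y) 0 ∂ν = callFn ν k + k - meanM ν := by
  have := h.1
  rw [call_add h]
  unfold meanM
  have i1 : Integrable (fun y => max y k) ν := h.2.sup (integrable_const k)
  rw [← integral_sub i1 h.2]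
  refine integral_congr_ae (ae_of_all _ fun y => ?_)
  simp only
  rw [← max_sub_sub_right, sub_self, max_comm]

lemma wker_int {ν : Measure ℝ} (h : MemM ν) (k : ℝ) :
    ∫⁻ y, wker y k ∂ν = if 0 < k then ENNReal.ofReal (callFn ν k)
      else ENNReal.ofReal (callFn ν k + k - meanM ν) := by
  have := h.1
  unfold wker
  split_ifs with hk
  · unfold callFn
    rw [ofReal_integral_eq_lintegral_ofReal (call_integrable h k)
      (ae_of_all _ fun _ => le_max_right _ _)]
    refine lintegral_congr fun y => ?_
    rw [ENNReal.ofReal_max]; simp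
  · have i1 : Integrable (fun y => max (k - y) 0) ν := ((integrable_const k).sub h.2).pos_part
    rw [← put_eq h, ofReal_integral_eq_lintegral_ofReal i1 (ae_of_all _ fun _ => le_max_right _ _)]
    refine lintegral_congr fun y => ?_
    simp [ENNReal.ofReal_max]

lemma convexOrder_of_call {μ ν : Measure ℝ} (h : MemM μ) (h' : MemM ν)
    (hc : ∀ x, callFn μ x ≤ callFn ν x) (hm : meanM μ = meanM ν) : ConvexOrder μ ν := by
  intro φ hφ hi hi'
  have P := h.1
  have P' := h'.1
  set c := rdS hφ 0 with hcdef
  have rep : ∀ ρ : Measure ℝ, MemM ρ → Integrable φ ρ →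
      Integrable (fun y => φ y - φ 0 - c * y) ρ ∧
      ∫ y, φ y ∂ρ = ∫ y, (φ y - φ 0 - c * y) ∂ρ + φ 0 + c * meanM ρ := by
    intro ρ hρ hiρ
    have := hρ.1
    have i1 : Integrable (fun y => φ y - φ 0) ρ := hiρ.sub (integrable_const _)
    refine ⟨i1.sub (hρ.2.const_mul c), ?_⟩
    rw [integral_sub i1 (hρ.2.const_mul c),
      integral_sub hiρ (integrable_const _), integral_const_mul]
    simp [meanM]; ring
  have lint : ∀ ρ : Measure ℝ, MemM ρ →
      ∫⁻ y, ENNReal.ofReal (φ y - φ 0 - c * y) ∂ρ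
        = ∫⁻ k, ∫⁻ y, wker y k ∂ρ ∂(rdS hφ).measure := by
    intro ρ hρ
    have := hρ.1
    rw [← lintegral_lintegral_swap wker_meas.aemeasurable]
    exact lintegral_congr fun y => (taylor_aux hφ y).2
  rw [(rep μ h hi).2, (rep ν h' hi').2, hm]
  have : ∫ y, (φ y - φ 0 - c * y) ∂μ ≤ ∫ y, (φ y - φ 0 - c * y) ∂ν := by
    have nn : ∀ ρ : Measure ℝ, 0 ≤ᵐ[ρ] fun y => φ y - φ 0 - c * y :=
      fun ρ => ae_of_all _ fun y => (taylor_aux hφ y).1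
    rw [← ENNReal.ofReal_le_ofReal_iff (integral_nonneg_of_ae (nn ν)),
      ofReal_integral_eq_lintegral_ofReal (rep μ h hi).1 (nn μ),
      ofReal_integral_eq_lintegral_ofReal (rep ν h' hi').1 (nn ν), lint μ h, lint ν h']
    refine lintegral_mono fun k => ?_
    rw [wker_int h, wker_int h', hm]
    split_ifs
    · exact ENNReal.ofReal_le_ofReal (hc k)
    · exact ENNReal.ofReal_le_ofReal (by linarith [hc k])
  linarith

end PartB
section PartC

lemma call_slope {μ : Measure ℝ} (h : MemM μ) {x y : ℝ} (hxy : x ≤ y) :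
    (y - x) * (1 - cdfM μ y) ≤ callFn μ x - callFn μ y ∧
    callFn μ x - callFn μ y ≤ (y - x) * (1 - cdfM μ x) := by
  rw [call_sub h hxy]
  have i0 := cdf_intOn h 0 x y
  simp only [add_zero] at i0
  have ic : ∀ c : ℝ, IntegrableOn (fun _ : ℝ => c) (Ioc x y) := fun c => integrable_const _
  have hc : ∀ c : ℝ, ∫ _t in Ioc x y, c = (y - x) * c := by
    intro c
    rw [setIntegral_const, Real.volume_real_Ioc_of_le hxy, smul_eq_mul]
  constructor
  · rw [← hc]
    refine setIntegral_mono_on (ic _) i0 measurableSet_Ioc fun t ht => ?_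
    linarith [cdfM_mono h ht.2]
  · rw [← hc]
    refine setIntegral_mono_on i0 (ic _) measurableSet_Ioc fun t ht => ?_
    linarith [cdfM_mono h ht.1.le]

lemma rdS_bounds {μ : Measure ℝ} (h : MemM μ) {ε : ℝ} {G : ℝ → ℝ}
    (hG : ConvexOn ℝ Set.univ G)
    (hinc : ∀ x y : ℝ, x ≤ y →
      callFn μ (y - ε) - callFn μ (x - ε) ≤ G y - G x ∧
      G y - G x ≤ callFn μ (y + ε) - callFn μ (x + ε)) (x : ℝ) :
    cdfM μ (x - ε) ≤ rdS hG x + 1 ∧ rdS hG x + 1 ≤ cdfM μ (x + ε) := by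
  constructor
  · have h1 : cdfM μ (x - ε) - 1 ≤ derivWithin G (Ioi x) x := by
      have hd := hG.hasDerivWithinAt_rightDeriv_of_mem_interior (x := x) (by simp)
      rw [hasDerivWithinAt_iff_tendsto_slope' (by simp)] at hd
      refine ge_of_tendsto hd ?_
      filter_upwards [self_mem_nhdsWithin] with y hy
      have hy : x < y := hy
      rw [slope_def_field, le_div_iff₀ (by linarith)]
      have a1 := (hinc x y hy.le).1
      have a2 := (call_slope h (by linarith : x - ε ≤ y - ε)).2
      nlinarith
    have h2 : derivWithin G (Ioi x) x ≤ rdS hG x := (rd_mono hG).le_rightLim le_rfl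
    linarith
  · refine ge_of_tendsto (cdfM_right h (x + ε)) ?_
    filter_upwards [self_mem_nhdsWithin] with z hz
    have hz : x + ε < z := hz
    set y := (x + (z - ε)) / 2 with hy
    have hxy : x < y := by rw [hy]; linarith
    have hyz : y < z - ε := by rw [hy]; linarith
    have h1 : rdS hG x ≤ derivWithin G (Ioi y) y := (rd_mono hG).rightLim_le hxy
    have h2 : derivWithin G (Ioi y) y ≤ slope G y (z - ε) :=
      hG.rightDeriv_le_slope_of_mem_interior (by simp) (by simp) hyz
    have h3 : slope G y (z - ε) ≤ cdfM μ z - 1 := by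
      rw [slope_def_field, div_le_iff₀ (by linarith)]
      have a1 := (hinc y (z - ε) hyz.le).2
      have a2 := (call_slope h (by linarith : y + ε ≤ z - ε + ε)).1
      rw [sub_add_cancel] at a1 a2
      nlinarith
    linarith

lemma exists_measure {μ : Measure ℝ} (h : MemM μ) {ε m : ℝ} {G : ℝ → ℝ}
    (hG : ConvexOn ℝ Set.univ G)
    (hinc : ∀ x y : ℝ, x ≤ y →
      callFn μ (y - ε) - callFn μ (x - ε) ≤ G y - G x ∧
      G y - G x ≤ callFn μ (y + ε) - callFn μ (x + ε))
    (hT : Tendsto G atTop (nhds 0)) (hB : Tendsto (fun x => G x + x) atBot (nhds m)) :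
    ∃ ν : Measure ℝ, MemM ν ∧
      (∀ x : ℝ, cdfM μ (x - ε) ≤ cdfM ν x ∧ cdfM ν x ≤ cdfM μ (x + ε)) ∧
      (∀ x, callFn ν x = G x) ∧ meanM ν = m := by
  have P := h.1
  set F : StieltjesFunction ℝ := rdS hG + StieltjesFunction.const ℝ 1 with hF
  have hFx : ∀ x, F x = rdS hG x + 1 := fun x => by
    rw [hF, StieltjesFunction.add_apply, StieltjesFunction.const_apply]
  have hb : ∀ x, cdfM μ (x - ε) ≤ F x ∧ F x ≤ cdfM μ (x + ε) := by
    intro x; rw [hFx]; exact rdS_bounds h hG hinc x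
  have tT : Tendsto (cdfM μ) atTop (nhds 1) := by
    rw [cdfM_eq h]; exact ProbabilityTheory.tendsto_cdf_atTop μ
  have tB : Tendsto (cdfM μ) atBot (nhds 0) := by
    rw [cdfM_eq h]; exact ProbabilityTheory.tendsto_cdf_atBot μ
  have FT : Tendsto F atTop (nhds 1) :=
    tendsto_of_tendsto_of_tendsto_of_le_of_le
      (tT.comp (tendsto_atTop_add_const_right _ (-ε) tendsto_id))
      (tT.comp (tendsto_atTop_add_const_right _ ε tendsto_id))
      (fun x => (hb x).1) (fun x => (hb x).2)
  have FB : Tendsto F atBot (nhds 0) :=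
    tendsto_of_tendsto_of_tendsto_of_le_of_le
      (tB.comp (tendsto_atBot_add_const_right _ (-ε) tendsto_id))
      (tB.comp (tendsto_atBot_add_const_right _ ε tendsto_id))
      (fun x => (hb x).1) (fun x => (hb x).2)
  have hP : IsProbabilityMeasure F.measure := F.isProbabilityMeasure FB FT
  have hcdf : ∀ x, cdfM F.measure x = F x := by
    intro x
    unfold cdfM
    rw [F.measure_Iic FB, sub_zero, ENNReal.toReal_ofReal]
    exact le_trans ENNReal.toReal_nonneg (hb x).1
  have hbν : ∀ x : ℝ, cdfM μ (x - ε) ≤ cdfM F.measure x ∧ cdfM F.measure x ≤ cdfM μ (x + ε) := by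
    intro x; rw [hcdf]; exact hb x
  have hM : MemM F.measure := ⟨hP, integrable_of_cdf h ε hbν⟩
  have hcall : ∀ x, callFn F.measure x = G x := by
    intro x
    have hsub : ∀ y, x ≤ y → callFn F.measure x - callFn F.measure y = G x - G y := by
      intro y hxy
      rw [call_sub hM hxy]
      have : ∀ t, 1 - cdfM F.measure t = - rdS hG t := by
        intro t; rw [hcdf, hFx]; ring
      simp_rw [this]
      rw [integral_neg, rdS_ftc hG hxy]; ring
    have l1 : Tendsto (fun y => callFn F.measure x - callFn F.measure y) atTop
        (nhds (callFn F.measure x - 0)) := (call_tendsto_top hM).const_sub _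
    have l2 : Tendsto (fun y => G x - G y) atTop (nhds (G x - 0)) := hT.const_sub _
    have l3 := l1.congr' (by
      filter_upwards [eventually_ge_atTop x] with y hy using hsub y hy)
    have := tendsto_nhds_unique l3 l2
    linarith
  refine ⟨F.measure, hM, hbν, hcall, ?_⟩
  have := call_tendsto_bot hM
  simp_rw [hcall] at this
  exact tendsto_nhds_unique this hB

/-- the transition kernel -/
noncomputable def dker (R : ℝ → ℝ) (ε y z : ℝ) : ℝ :=
  R (z + ε * Real.sign (y - z)) - R (y + ε * Real.sign (y - z))

lemma dker_self (R : ℝ → ℝ) (ε y : ℝ) : dker R ε y y = 0 := by simp [dker]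

lemma dker_lt (R : ℝ → ℝ) (ε : ℝ) {y z : ℝ} (h : y < z) :
    dker R ε y z = R (z - ε) - R (y - ε) := by
  unfold dker
  rw [Real.sign_of_neg (by linarith)]
  ring_nf

lemma dker_gt (R : ℝ → ℝ) (ε : ℝ) {y z : ℝ} (h : z < y) :
    dker R ε y z = R (z + ε) - R (y + ε) := by
  unfold dker
  rw [Real.sign_of_pos (by linarith)]
  ring_nf

/-- increments of a convex function increase under shifts -/
lemma convex_incr {R : ℝ → ℝ} (hR : ConvexOn ℝ Set.univ R) {ε : ℝ} (hε : 0 < ε) {x y : ℝ}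
    (hxy : x < y) : R (y - ε) - R (x - ε) ≤ R (y + ε) - R (x + ε) := by
  have s1 := hR.secant_mono (a := x - ε) (x := y - ε) (y := y + ε) (mem_univ _) (mem_univ _)
    (mem_univ _) (by linarith) (by linarith) (by linarith)
  have s2 := hR.secant_mono (a := y + ε) (x := x - ε) (y := x + ε) (mem_univ _) (mem_univ _)
    (mem_univ _) (by linarith) (by linarith) (by linarith)
  have e1 : (R (y + ε) - R (x - ε)) / (y + ε - (x - ε)) =
      (R (x - ε) - R (y + ε)) / (x - ε - (y + ε)) := by
    rw [← neg_sub (R (x - ε)), ← neg_sub (x - ε), neg_div_neg_eq]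
  have e2 : (R (x + ε) - R (y + ε)) / (x + ε - (y + ε)) =
      (R (y + ε) - R (x + ε)) / (y - x) := by
    rw [← neg_sub (R (y + ε)), ← neg_sub (y + ε), neg_div_neg_eq]; ring_nf
  have e3 : (R (y - ε) - R (x - ε)) / (y - ε - (x - ε)) = (R (y - ε) - R (x - ε)) / (y - x) := by
    ring_nf
  rw [e1, e3] at s1
  rw [e2] at s2
  exact (div_le_div_iff_of_pos_right (by linarith)).1 (s1.trans s2)

lemma dker_tri {R : ℝ → ℝ} (hR : ConvexOn ℝ Set.univ R) {ε : ℝ} (hε : 0 < ε) (x y z : ℝ) :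
    dker R ε x y + dker R ε y z ≤ dker R ε x z := by
  rcases lt_trichotomy x y with h1 | h1 | h1
  · rcases lt_trichotomy y z with h2 | h2 | h2
    · rw [dker_lt _ _ h1, dker_lt _ _ h2, dker_lt _ _ (h1.trans h2)]; linarith
    · subst h2; rw [dker_self]; linarith
    · rcases lt_trichotomy x z with h3 | h3 | h3
      · rw [dker_lt _ _ h1, dker_gt _ _ h2, dker_lt _ _ h3]
        linarith [convex_incr hR hε h2]
      · subst h3
        rw [dker_lt _ _ h1, dker_gt _ _ h2, dker_self]
        linarith [convex_incr hR hε h2]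
      · rw [dker_lt _ _ h1, dker_gt _ _ h2, dker_gt _ _ h3]
        linarith [convex_incr hR hε h1]
  · subst h1; rw [dker_self]; linarith
  · rcases lt_trichotomy y z with h2 | h2 | h2
    · rcases lt_trichotomy x z with h3 | h3 | h3
      · rw [dker_gt _ _ h1, dker_lt _ _ h2, dker_lt _ _ h3]
        linarith [convex_incr hR hε h1]
      · subst h3
        rw [dker_gt _ _ h1, dker_lt _ _ h2, dker_self]
        linarith [convex_incr hR hε h2]
      · rw [dker_gt _ _ h1, dker_lt _ _ h2, dker_gt _ _ h3]
        linarith [convex_incr hR hε h2]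
    · subst h2; rw [dker_self]; linarith
    · rw [dker_gt _ _ h1, dker_gt _ _ h2, dker_gt _ _ (h2.trans h1)]; linarith

/-- one-sided convexity step -/
lemma conv_step {H f : ℝ → ℝ} (hH : ConvexOn ℝ Set.univ H) (hf : ConvexOn ℝ Set.univ f)
    {x1 x2 a b k1 k2 y : ℝ} (h12 : x1 < x2) (ha : 0 < a) (hb : 0 < b) (hab : a + b = 1)
    (hk1 : ∀ y, x1 ≤ y → H y + (f x1 - f y) ≤ k1) (hk2 : ∀ y, x2 ≤ y → H y + (f x2 - f y) ≤ k2)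
    (hy : a * x1 + b * x2 ≤ y) :
    H y + (f (a * x1 + b * x2) - f y) ≤ a * k1 + b * k2 := by
  set x := a * x1 + b * x2 with hx
  have hb' : b = 1 - a := by linarith
  have hx1 : x1 < x := by rw [hx, hb']; nlinarith
  have hx2 : x < x2 := by rw [hx, hb']; nlinarith
  have fx : f x ≤ a * f x1 + b * f x2 := by
    simpa using hf.2 (mem_univ x1) (mem_univ x2) ha.le hb.le hab
  have Hx : H x ≤ a * H x1 + b * H x2 := by
    simpa using hH.2 (mem_univ x1) (mem_univ x2) ha.le hb.le hab
  have q1 : a * H x1 ≤ a * k1 :=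
    mul_le_mul_of_nonneg_left (by linarith [hk1 x1 le_rfl]) ha.le
  have q2 : b * H x2 ≤ b * k2 :=
    mul_le_mul_of_nonneg_left (by linarith [hk2 x2 le_rfl]) hb.le
  have q3 : a * (H y + (f x1 - f y)) ≤ a * k1 :=
    mul_le_mul_of_nonneg_left (hk1 y (by linarith)) ha.le
  rcases le_or_gt x2 y with h2 | h2
  · have q4 : b * (H y + (f x2 - f y)) ≤ b * k2 :=
      mul_le_mul_of_nonneg_left (hk2 y h2) hb.le
    have : a * (H y - f y) + b * (H y - f y) = H y - f y := by rw [← add_mul, hab, one_mul]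
    nlinarith
  · rcases le_or_gt (H y - f y) (H x - f x) with h3 | h3
    · linarith
    · have hxy : x < y := lt_of_le_of_ne hy (by rintro h; rw [h] at h3; exact lt_irrefl _ h3)
      have s1 := hH.slope_mono_adjacent (mem_univ x) (mem_univ x2) hxy h2
      have s2 := hf.slope_mono_adjacent (mem_univ x1) (mem_univ y) hx1 hxy
      set s := (f y - f x) / (y - x) with hs
      have e1 : f y - f x = s * (y - x) := by
        rw [hs]; field_simp [(sub_pos.2 hxy).ne']
      have e2 : s ≤ (H y - H x) / (y - x) := by
        rw [hs]; exact div_le_div_of_nonneg_right (by linarith) (by linarith)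
      have e3 : s * (x2 - y) ≤ H x2 - H y := by
        rw [← le_div_iff₀ (by linarith)]; exact e2.trans s1
      have e4 : f x - f x1 ≤ s * (x - x1) := by
        rw [← div_le_iff₀ (by linarith)]; exact s2
      have e3' := mul_le_mul_of_nonneg_left e3 hb.le
      have e4' := mul_le_mul_of_nonneg_left e4 ha.le
      have e5 : a * (x - x1) = b * (x2 - x) := by rw [hx, hb']; ring
      have e6 : a * (s * (x - x1)) = s * (b * (x2 - x)) := by rw [← e5]; ring
      have ea : a = 1 - b := by linarith
      subst hb'
      nlinarith

lemma convex_reflect {f : ℝ → ℝ} (hf : ConvexOn ℝ Set.univ f) :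
    ConvexOn ℝ Set.univ (fun x => f (-x)) := by
  refine ⟨convex_univ, ?_⟩
  intro x _ y _ a b ha hb hab
  have := hf.2 (mem_univ (-x)) (mem_univ (-y)) ha hb hab
  simp only [smul_eq_mul] at this ⊢
  rwa [show -(a * x + b * y) = a * -x + b * -y by ring]

lemma convex_shift {f : ℝ → ℝ} (hf : ConvexOn ℝ Set.univ f) (c : ℝ) :
    ConvexOn ℝ Set.univ (fun x => f (x + c)) := by
  refine ⟨convex_univ, ?_⟩
  intro x _ y _ a b ha hb hab
  have := hf.2 (mem_univ (x + c)) (mem_univ (y + c)) ha hb hab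
  simp only [smul_eq_mul] at this ⊢
  rwa [show a * x + b * y + c = a * (x + c) + b * (y + c) by
    have : c = (a + b) * c := by rw [hab, one_mul]
    nth_rewrite 1 [this]; ring]

lemma conv_T {H K R : ℝ → ℝ} {ε : ℝ} (hH : ConvexOn ℝ Set.univ H) (hR : ConvexOn ℝ Set.univ R)
    (h1 : ∀ y z, H y + dker R ε y z ≤ K z)
    (h2 : ∀ z c, (∀ y, H y + dker R ε y z ≤ c) → K z ≤ c) : ConvexOn ℝ Set.univ K := by
  refine LinearOrder.convexOn_of_lt convex_univ ?_
  intro x1 _ x2 _ h12 a b ha hb hab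
  simp only [smul_eq_mul]
  have k1 : ∀ x y, x ≤ y → H y + (R (x + ε) - R (y + ε)) ≤ K x := by
    intro x y hxy
    rcases hxy.eq_or_lt with rfl | hlt
    · have := h1 x x; rw [dker_self] at this; linarith
    · have := h1 y x; rwa [dker_gt _ _ hlt] at this
  have k2 : ∀ x y, y ≤ x → H y + (R (x - ε) - R (y - ε)) ≤ K x := by
    intro x y hxy
    rcases hxy.eq_or_lt with rfl | hlt
    · have := h1 y y; rw [dker_self] at this; linarith
    · have := h1 y x; rwa [dker_lt _ _ hlt] at this
  refine h2 _ _ fun y => ?_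
  rcases lt_trichotomy y (a * x1 + b * x2) with hy | hy | hy
  · rw [dker_lt _ _ hy]
    have := conv_step (H := fun t => H (-t)) (f := fun t => R (-t - ε)) (x1 := -x2) (x2 := -x1)
      (a := b) (b := a) (k1 := K x2) (k2 := K x1) (y := -y)
      (convex_reflect hH) (convex_reflect (convex_shift hR (-ε)))
      (by linarith) hb ha (by linarith)
      (fun t ht => by have := k2 x2 (-t) (by linarith); simpa using this)
      (fun t ht => by have := k2 x1 (-t) (by linarith); simpa using this)
      (by linarith)
    simp only [neg_neg] at this
    rw [show -(b * -x2 + a * -x1) = a * x1 + b * x2 by ring] at this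
    linarith
  · have a1 := k1 x1 x1 le_rfl
    have a2 := k1 x2 x2 le_rfl
    have a3 := mul_le_mul_of_nonneg_left (show H x1 ≤ K x1 by linarith) ha.le
    have a4 := mul_le_mul_of_nonneg_left (show H x2 ≤ K x2 by linarith) hb.le
    have := hH.2 (mem_univ x1) (mem_univ x2) ha.le hb.le hab
    simp only [smul_eq_mul] at this
    rw [hy, dker_self]; linarith
  · rw [dker_gt _ _ hy]
    exact conv_step (f := fun t => R (t + ε)) hH (convex_shift hR ε) h12 ha hb hab
      (k1 x1) (k1 x2) hy.le

end PartC
section PartD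

lemma sub_eq_shift (R : ℝ → ℝ) (ε : ℝ) : (fun x => R (x - ε)) = fun x => R (x + -ε) := by
  funext x; rw [sub_eq_add_neg]

lemma Rmin_convex {μ : Measure ℝ} (h : MemM μ) (m ε : ℝ) :
    ConvexOn ℝ Set.univ (RminW μ m ε) := by
  have c1 : ConvexOn ℝ Set.univ (fun x => callFn μ (x - ε)) := by
    rw [sub_eq_shift]; exact convex_shift (callFn_convex h) _
  have c2 : ConvexOn ℝ Set.univ (fun x => callFn μ (x + ε)) := convex_shift (callFn_convex h) _
  have c3 := (c1.add_const (m - (meanM μ + ε))).sup c2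
  refine c3.congr fun x _ => ?_
  simp only [RminW, Pi.sup_apply, Pi.add_apply]
  congr 1; ring

lemma incr_of_dker {R K : ℝ → ℝ} {ε : ℝ} (h : ∀ y z, K y + dker R ε y z ≤ K z) (x y : ℝ)
    (hxy : x ≤ y) : R (y - ε) - R (x - ε) ≤ K y - K x ∧ K y - K x ≤ R (y + ε) - R (x + ε) := by
  rcases hxy.eq_or_lt with rfl | hlt
  · simp
  · have a1 := h x y
    have a2 := h y x
    rw [dker_lt _ _ hlt] at a1
    rw [dker_gt _ _ hlt] at a2
    constructor <;> linarith

lemma dker_of_incr {R K : ℝ → ℝ} {ε : ℝ}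
    (h : ∀ x y, x ≤ y → R (y - ε) - R (x - ε) ≤ K y - K x ∧ K y - K x ≤ R (y + ε) - R (x + ε))
    (y z : ℝ) : K y + dker R ε y z ≤ K z := by
  rcases lt_trichotomy y z with h1 | h1 | h1
  · rw [dker_lt _ _ h1]; linarith [(h y z h1.le).1]
  · subst h1; rw [dker_self]; linarith
  · rw [dker_gt _ _ h1]; linarith [(h z y h1.le).2]

lemma Rmin_incr {μ : Measure ℝ} (h : MemM μ) (m : ℝ) {ε : ℝ} (hε : 0 < ε) (x y : ℝ)
    (hxy : x ≤ y) :
    callFn μ (y - ε) - callFn μ (x - ε) ≤ RminW μ m ε y - RminW μ m ε x ∧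
    RminW μ m ε y - RminW μ m ε x ≤ callFn μ (y + ε) - callFn μ (x + ε) := by
  have hc : callFn μ (y - ε) - callFn μ (x - ε) ≤ callFn μ (y + ε) - callFn μ (x + ε) := by
    rcases hxy.eq_or_lt with rfl | hlt
    · simp
    · exact convex_incr (callFn_convex h) hε hlt
  have y1 : m + callFn μ (y - ε) - (meanM μ + ε) ≤ RminW μ m ε y := le_max_left _ _
  have y2 : callFn μ (y + ε) ≤ RminW μ m ε y := le_max_right _ _
  have x1 : m + callFn μ (x - ε) - (meanM μ + ε) ≤ RminW μ m ε x := le_max_left _ _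
  have x2 : callFn μ (x + ε) ≤ RminW μ m ε x := le_max_right _ _
  constructor
  · have : RminW μ m ε x ≤ RminW μ m ε y - (callFn μ (y - ε) - callFn μ (x - ε)) :=
      max_le (by linarith) (by linarith)
    linarith
  · have : RminW μ m ε y ≤ RminW μ m ε x + (callFn μ (y + ε) - callFn μ (x + ε)) :=
      max_le (by linarith) (by linarith)
    linarith

lemma Rmax_le {μ : Measure ℝ} {m ε : ℝ} (hm : meanM μ - ε ≤ m) (x : ℝ) :
    RmaxW μ m ε x ≤ m + callFn μ (x + ε) - (meanM μ - ε) ∧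
    RmaxW μ m ε x ≤ callFn μ (x - ε) := by
  have n1 := callFn_nonneg μ (x + ε)
  have n2 := callFn_nonneg μ (x - ε)
  constructor
  · refine Real.sSup_le ?_ (by linarith)
    rintro z ⟨h, -, hle, rfl⟩
    exact (hle x).trans (min_le_left _ _)
  · refine Real.sSup_le ?_ n2
    rintro z ⟨h, -, hle, rfl⟩
    exact (hle x).trans (min_le_right _ _)

lemma le_Rmax {μ : Measure ℝ} {m ε : ℝ} {h : ℝ → ℝ} (hc : ConvexOn ℝ Set.univ h)
    (h1 : ∀ x, h x ≤ m + callFn μ (x + ε) - (meanM μ - ε)) (h2 : ∀ x, h x ≤ callFn μ (x - ε))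
    (x : ℝ) : h x ≤ RmaxW μ m ε x := by
  refine le_csSup ⟨callFn μ (x - ε), ?_⟩ ⟨h, hc, fun y => le_min (h1 y) (h2 y), rfl⟩
  rintro z ⟨g, -, hle, rfl⟩
  exact (hle x).trans (min_le_right _ _)

noncomputable def pathSum (μ : ℕ → Measure ℝ) (m ε : ℝ) (N : ℕ) (x : ℕ → ℝ) : ℝ :=
  RminW (μ 0) m ε (x 0)
    + ∑ n ∈ Finset.Ico 1 (N + 1), dker (callFn (μ n)) ε (x (n - 1)) (x n)

lemma Phi_eq (μ : ℕ → Measure ℝ) (m ε : ℝ) (N : ℕ) (x : ℕ → ℝ) :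
    PhiW μ m ε (N + 1) x = pathSum μ m ε N x - RmaxW (μ (N + 1)) m ε (x N) := rfl

lemma pathSum_succ (μ : ℕ → Measure ℝ) (m ε : ℝ) (N : ℕ) (x : ℕ → ℝ) :
    pathSum μ m ε (N + 1) x
      = pathSum μ m ε N x + dker (callFn (μ (N + 1))) ε (x N) (x (N + 1)) := by
  unfold pathSum
  rw [Finset.sum_Ico_succ_top (by omega)]
  simp [add_assoc]

noncomputable def Gfun (μ : ℕ → Measure ℝ) (m ε : ℝ) (N : ℕ) (z : ℝ) : ℝ :=
  sSup {v | ∃ x : ℕ → ℝ, x N = z ∧ v = pathSum μ m ε N x}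

section
variable {μ : ℕ → Measure ℝ} {m ε : ℝ}

lemma G_bdd (hΦ : ∀ N : ℕ, 1 ≤ N → ∀ x : ℕ → ℝ, PhiW μ m ε N x ≤ 0) (N : ℕ) (z : ℝ) :
    ∀ v ∈ {v | ∃ x : ℕ → ℝ, x N = z ∧ v = pathSum μ m ε N x}, v ≤ RmaxW (μ (N + 1)) m ε z := by
  rintro v ⟨x, rfl, rfl⟩
  have := hΦ (N + 1) (by omega) x
  rw [Phi_eq] at this
  linarith

lemma G_le (hΦ : ∀ N : ℕ, 1 ≤ N → ∀ x : ℕ → ℝ, PhiW μ m ε N x ≤ 0) (N : ℕ) (z : ℝ) :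
    Gfun μ m ε N z ≤ RmaxW (μ (N + 1)) m ε z :=
  csSup_le ⟨_, fun _ => z, rfl, rfl⟩ (G_bdd hΦ N z)

lemma path_le_G (hΦ : ∀ N : ℕ, 1 ≤ N → ∀ x : ℕ → ℝ, PhiW μ m ε N x ≤ 0) (N : ℕ) (x : ℕ → ℝ) :
    pathSum μ m ε N x ≤ Gfun μ m ε N (x N) :=
  le_csSup ⟨_, G_bdd hΦ N (x N)⟩ ⟨x, rfl, rfl⟩

lemma G_le_of (N : ℕ) (z c : ℝ) (h : ∀ x : ℕ → ℝ, x N = z → pathSum μ m ε N x ≤ c) :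
    Gfun μ m ε N z ≤ c := by
  refine csSup_le ⟨_, fun _ => z, rfl, rfl⟩ ?_
  rintro v ⟨x, hx, rfl⟩
  exact h x hx

lemma G_zero (z : ℝ) : Gfun μ m ε 0 z = RminW (μ 0) m ε z := by
  have : {v | ∃ x : ℕ → ℝ, x 0 = z ∧ v = pathSum μ m ε 0 x} = {RminW (μ 0) m ε z} := by
    ext v; constructor
    · rintro ⟨x, rfl, rfl⟩; simp [pathSum]
    · rintro rfl; exact ⟨fun _ => z, rfl, by simp [pathSum]⟩
  rw [Gfun, this, csSup_singleton]

lemma G_step_le (hΦ : ∀ N : ℕ, 1 ≤ N → ∀ x : ℕ → ℝ, PhiW μ m ε N x ≤ 0) (N : ℕ) (y z : ℝ) :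
    Gfun μ m ε N y + dker (callFn (μ (N + 1))) ε y z ≤ Gfun μ m ε (N + 1) z := by
  rw [← le_sub_iff_add_le]
  refine G_le_of _ _ _ fun x hx => ?_
  rw [le_sub_iff_add_le]
  have := path_le_G hΦ (N + 1) (fun n => if n ≤ N then x n else z)
  rw [pathSum_succ] at this
  have e : pathSum μ m ε N (fun n => if n ≤ N then x n else z) = pathSum μ m ε N x := by
    unfold pathSum
    congr 1
    refine Finset.sum_congr rfl fun n hn => ?_
    have := (Finset.mem_Ico.1 hn).2
    simp only
    rw [if_pos (by omega), if_pos (by omega)]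
  rw [e] at this
  simpa [hx] using this

lemma G_step_min (hΦ : ∀ N : ℕ, 1 ≤ N → ∀ x : ℕ → ℝ, PhiW μ m ε N x ≤ 0) (N : ℕ) (z c : ℝ)
    (h : ∀ y, Gfun μ m ε N y + dker (callFn (μ (N + 1))) ε y z ≤ c) :
    Gfun μ m ε (N + 1) z ≤ c := by
  refine G_le_of _ _ _ fun x hx => ?_
  rw [pathSum_succ, hx]
  linarith [h (x N), path_le_G hΦ N x]

lemma G_convex (hμ : ∀ n, MemM (μ n))
    (hΦ : ∀ N : ℕ, 1 ≤ N → ∀ x : ℕ → ℝ, PhiW μ m ε N x ≤ 0) (N : ℕ) :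
    ConvexOn ℝ Set.univ (Gfun μ m ε N) := by
  induction N with
  | zero =>
    exact (Rmin_convex (hμ 0) m ε).congr fun x _ => (G_zero x).symm
  | succ N ih =>
    exact conv_T ih (callFn_convex (hμ (N + 1))) (G_step_le hΦ N) (G_step_min hΦ N)

lemma G_incr (hε : 0 < ε) (hμ : ∀ n, MemM (μ n))
    (hΦ : ∀ N : ℕ, 1 ≤ N → ∀ x : ℕ → ℝ, PhiW μ m ε N x ≤ 0) (N : ℕ) (x y : ℝ) (hxy : x ≤ y) :
    callFn (μ N) (y - ε) - callFn (μ N) (x - ε) ≤ Gfun μ m ε N y - Gfun μ m ε N x ∧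
    Gfun μ m ε N y - Gfun μ m ε N x ≤ callFn (μ N) (y + ε) - callFn (μ N) (x + ε) := by
  cases N with
  | zero => rw [G_zero, G_zero]; exact Rmin_incr (hμ 0) m hε x y hxy
  | succ N =>
    refine incr_of_dker ?_ x y hxy
    intro y z
    rw [← le_sub_iff_add_le]
    refine G_step_min hΦ N _ _ fun w => ?_
    linarith [G_step_le hΦ N w z, dker_tri (callFn_convex (hμ (N + 1))) hε w y z]

lemma G_mono_succ (hΦ : ∀ N : ℕ, 1 ≤ N → ∀ x : ℕ → ℝ, PhiW μ m ε N x ≤ 0) (N : ℕ) (z : ℝ) :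
    Gfun μ m ε N z ≤ Gfun μ m ε (N + 1) z := by
  have := G_step_le hΦ N z z
  rw [dker_self] at this; linarith

lemma G_mono (hΦ : ∀ N : ℕ, 1 ≤ N → ∀ x : ℕ → ℝ, PhiW μ m ε N x ≤ 0) (z : ℝ) :
    Monotone (fun N => Gfun μ m ε N z) :=
  monotone_nat_of_le_succ fun N => G_mono_succ hΦ N z

end

lemma suff_dir {μ : ℕ → Measure ℝ} {m ε : ℝ} (hε : 0 < ε) (hμ : ∀ n, MemM (μ n))
    (hm : m ∈ ⋂ n : ℕ, Set.Icc (meanM (μ n) - ε) (meanM (μ n) + ε))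
    (hΦ : ∀ N : ℕ, 1 ≤ N → ∀ x : ℕ → ℝ, PhiW μ m ε N x ≤ 0) :
    ∃ ν : ℕ → Measure ℝ, (∀ n, MemM (ν n)) ∧
        (∀ j k : ℕ, j ≤ k → ConvexOrder (ν j) (ν k)) ∧
        (∀ n, Winf (μ n) (ν n) ≤ ENNReal.ofReal ε) ∧
        (∀ n, meanM (ν n) = m) := by
  have hm' : ∀ n, meanM (μ n) - ε ≤ m ∧ m ≤ meanM (μ n) + ε := fun n => Set.mem_iInter.1 hm n
  have lo : ∀ N z, RminW (μ 0) m ε z ≤ Gfun μ m ε N z := by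
    intro N z
    rw [← G_zero]
    exact G_mono hΦ z (Nat.zero_le N)
  have sP : ∀ c : ℝ, Tendsto (fun x : ℝ => x + c) atTop atTop :=
    fun c => tendsto_atTop_add_const_right _ c tendsto_id
  have sB : ∀ c : ℝ, Tendsto (fun x : ℝ => x + c) atBot atBot :=
    fun c => tendsto_atBot_add_const_right _ c tendsto_id
  have tT : ∀ N, Tendsto (Gfun μ m ε N) atTop (nhds 0) := by
    intro N
    refine tendsto_of_tendsto_of_tendsto_of_le_of_le tendsto_const_nhds
      ((call_tendsto_top (hμ (N + 1))).comp (sP (-ε))) ?_ ?_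
    · intro z
      exact le_trans (le_trans (callFn_nonneg (μ 0) (z + ε)) (le_max_right _ _)) (lo N z)
    · intro z
      exact (G_le hΦ N z).trans (Rmax_le (hm' (N + 1)).1 z).2
  have tB : ∀ N, Tendsto (fun x => Gfun μ m ε N x + x) atBot (nhds m) := by
    intro N
    have l1 : Tendsto (fun x => (callFn (μ 0) (x + -ε) + (x + -ε)) + (m - meanM (μ 0))) atBot
        (nhds (meanM (μ 0) + (m - meanM (μ 0)))) :=
      ((call_tendsto_bot (hμ 0)).comp (sB (-ε))).add_const _
    have l2 : Tendsto (fun x => (callFn (μ (N + 1)) (x + ε) + (x + ε)) + (m - meanM (μ (N + 1))))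
        atBot (nhds (meanM (μ (N + 1)) + (m - meanM (μ (N + 1))))) :=
      ((call_tendsto_bot (hμ (N + 1))).comp (sB ε)).add_const _
    rw [add_sub_cancel] at l1 l2
    refine tendsto_of_tendsto_of_tendsto_of_le_of_le l1 l2 ?_ ?_
    · intro z
      have a1 := lo N z
      have a2 : m + callFn (μ 0) (z - ε) - (meanM (μ 0) + ε) ≤ RminW (μ 0) m ε z := le_max_left _ _
      rw [sub_eq_add_neg z] at a2
      simp only
      linarith
    · intro z
      have a1 := G_le hΦ N z
      have a2 := (Rmax_le (hm' (N + 1)).1 z).1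
      simp only
      linarith
  have ex : ∀ N, ∃ ν : Measure ℝ, MemM ν ∧
      (∀ x : ℝ, cdfM (μ N) (x - ε) ≤ cdfM ν x ∧ cdfM ν x ≤ cdfM (μ N) (x + ε)) ∧
      (∀ x, callFn ν x = Gfun μ m ε N x) ∧ meanM ν = m := fun N =>
    exists_measure (hμ N) (G_convex hμ hΦ N) (G_incr hε hμ hΦ N) (tT N) (tB N)
  choose ν h1 h2 h3 h4 using ex
  refine ⟨ν, h1, ?_, fun n => winf_of_cdf hε (h2 n), h4⟩
  intro j k hjk
  refine convexOrder_of_call (h1 j) (h1 k) (fun x => ?_) (by rw [h4, h4])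
  rw [h3, h3]
  exact G_mono hΦ x hjk

lemma nec_bounds {μ ν : Measure ℝ} {ε : ℝ} (h : MemM μ) (h' : MemM ν)
    (hc : ∀ x : ℝ, cdfM μ (x - ε) ≤ cdfM ν x ∧ cdfM ν x ≤ cdfM μ (x + ε)) (x : ℝ) :
    callFn μ (x + ε) ≤ callFn ν x ∧ callFn ν x ≤ callFn μ (x - ε) ∧
    meanM ν + callFn μ (x - ε) - (meanM μ + ε) ≤ callFn ν x ∧
    callFn ν x ≤ meanM ν + callFn μ (x + ε) - (meanM μ - ε) := by
  have sP : ∀ c : ℝ, Tendsto (fun x : ℝ => x + c) atTop atTop :=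
    fun c => tendsto_atTop_add_const_right _ c tendsto_id
  have sB : ∀ c : ℝ, Tendsto (fun x : ℝ => x + c) atBot atBot :=
    fun c => tendsto_atBot_add_const_right _ c tendsto_id
  have t0 := call_tendsto_top h'
  have t1 := (call_tendsto_top h).comp (sP ε)
  have t2 := (call_tendsto_top h).comp (sP (-ε))
  have b0 := call_tendsto_bot h'
  have b1 := (call_tendsto_bot h).comp (sB ε)
  have b2 := (call_tendsto_bot h).comp (sB (-ε))
  refine ⟨?_, ?_, ?_, ?_⟩
  · have := le_of_tendsto_of_tendsto (t0.sub_const (callFn ν x)) (t1.sub_const (callFn μ (x + ε)))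
      (by
        filter_upwards [eventually_ge_atTop x] with y hy
        exact (incr_of_cdf h h' hc hy).2)
    linarith
  · have := le_of_tendsto_of_tendsto (t2.sub_const (callFn μ (x - ε))) (t0.sub_const (callFn ν x))
      (by
        filter_upwards [eventually_ge_atTop x] with y hy
        have := (incr_of_cdf h h' hc hy).1
        simpa [← sub_eq_add_neg] using this)
    linarith
  · have := le_of_tendsto_of_tendsto (b0.sub_const (callFn ν x))
      (b2.sub_const (callFn μ (x - ε) - ε))
      (by
        filter_upwards [eventually_le_atBot x] with y hy
        have := (incr_of_cdf h h' hc hy).1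
        simp only [Function.comp, ← sub_eq_add_neg]
        linarith)
    linarith
  · have := le_of_tendsto_of_tendsto (b1.sub_const (callFn μ (x + ε) + ε))
      (b0.sub_const (callFn ν x))
      (by
        filter_upwards [eventually_le_atBot x] with y hy
        have := (incr_of_cdf h h' hc hy).2
        simp only [Function.comp]
        linarith)
    linarith

lemma nec_dir {μ ν : ℕ → Measure ℝ} {ε : ℝ} (hε : 0 < ε) (hμ : ∀ n, MemM (μ n))
    (hν : ∀ n, MemM (ν n)) (hp : ∀ j k : ℕ, j ≤ k → ConvexOrder (ν j) (ν k))
    (hw : ∀ n, Winf (μ n) (ν n) ≤ ENNReal.ofReal ε) :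
    ∃ m ∈ ⋂ n : ℕ, Set.Icc (meanM (μ n) - ε) (meanM (μ n) + ε),
        ∀ N : ℕ, 1 ≤ N → ∀ x : ℕ → ℝ, PhiW μ m ε N x ≤ 0 := by
  have hc := fun n => cdf_of_winf (hμ n) (hν n) hε (hw n)
  have hmean : ∀ n, meanM (ν n) = meanM (ν 0) := by
    intro n
    have a1 := hp 0 n (Nat.zero_le n) (fun y => y) (convexOn_id convex_univ) (hν 0).2 (hν n).2
    have a2 := hp 0 n (Nat.zero_le n) (fun y => -y) ((concaveOn_id convex_univ).neg)
      (hν 0).2.neg (hν n).2.neg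
    rw [integral_neg, integral_neg] at a2
    unfold meanM
    linarith
  have hcall : ∀ j k, j ≤ k → ∀ x, callFn (ν j) x ≤ callFn (ν k) x := by
    intro j k hjk x
    have hcv : ConvexOn ℝ Set.univ (fun y : ℝ => max (y - x) 0) := by
      have : ConvexOn ℝ Set.univ (fun y : ℝ => y + -x) := (convexOn_id convex_univ).add_const (-x)
      have h2 := this.sup (convexOn_const (0 : ℝ) convex_univ)
      refine h2.congr fun y _ => ?_
      simp [sub_eq_add_neg]
    exact hp j k hjk _ hcv (call_integrable (hν j) x) (call_integrable (hν k) x)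
  refine ⟨meanM (ν 0), ?_, ?_⟩
  · rw [Set.mem_iInter]
    intro n
    obtain ⟨b1, b2, b3, b4⟩ := nec_bounds (hμ n) (hν n) (hc n) 0
    rw [hmean] at b3 b4
    constructor <;> linarith
  · intro N hN x
    obtain ⟨N, rfl⟩ : ∃ k, N = k + 1 := ⟨N - 1, by omega⟩
    rw [Phi_eq]
    have path : pathSum μ (meanM (ν 0)) ε N x ≤ callFn (ν N) (x N) := by
      clear hN
      induction N with
      | zero =>
        obtain ⟨b1, b2, b3, b4⟩ := nec_bounds (hμ 0) (hν 0) (hc 0) (x 0)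
        simp only [pathSum, zero_add, Finset.Ico_self, Finset.sum_empty, add_zero]
        exact max_le b3 b1
      | succ N ih =>
        rw [pathSum_succ]
        have a1 := dker_of_incr (fun s t hst =>
          incr_of_cdf (hμ (N + 1)) (hν (N + 1)) (hc (N + 1)) hst) (x N) (x (N + 1))
        have a2 := hcall N (N + 1) (Nat.le_succ N) (x N)
        linarith
    have up : callFn (ν (N + 1)) (x N) ≤ RmaxW (μ (N + 1)) (meanM (ν 0)) ε (x N) := by
      refine le_Rmax (callFn_convex (hν _)) (fun y => ?_) (fun y => ?_) _
      · have := (nec_bounds (hμ (N + 1)) (hν (N + 1)) (hc (N + 1)) y).2.2.2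
        rwa [hmean] at this
      · exact (nec_bounds (hμ (N + 1)) (hν (N + 1)) (hc (N + 1)) y).2.1
    linarith [hcall N (N + 1) (Nat.le_succ N) (x N)]

end PartD

/-- main theorem; existence of a peacock within `W∞`-distance `ε`
iff `Φ_N(·; m, ε) ≤ 0` for some `m ∈ I`; the peacock can then have mean `m`. -/
theorem strassen_winf (ε : ℝ) (hε : 0 < ε) (μ : ℕ → Measure ℝ) (hμ : ∀ n, MemM (μ n))
    (hI : (⋂ n : ℕ, Set.Icc (meanM (μ n) - ε) (meanM (μ n) + ε)).Nonempty) :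
    ((∃ ν : ℕ → Measure ℝ, (∀ n, MemM (ν n)) ∧
        (∀ j k : ℕ, j ≤ k → ConvexOrder (ν j) (ν k)) ∧
        (∀ n, Winf (μ n) (ν n) ≤ ENNReal.ofReal ε)) ↔
      (∃ m ∈ ⋂ n : ℕ, Set.Icc (meanM (μ n) - ε) (meanM (μ n) + ε),
        ∀ N : ℕ, 1 ≤ N → ∀ x : ℕ → ℝ, PhiW μ m ε N x ≤ 0)) ∧
    (∀ m ∈ ⋂ n : ℕ, Set.Icc (meanM (μ n) - ε) (meanM (μ n) + ε),
      (∀ N : ℕ, 1 ≤ N → ∀ x : ℕ → ℝ, PhiW μ m ε N x ≤ 0) →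
      ∃ ν : ℕ → Measure ℝ, (∀ n, MemM (ν n)) ∧
        (∀ j k : ℕ, j ≤ k → ConvexOrder (ν j) (ν k)) ∧
        (∀ n, Winf (μ n) (ν n) ≤ ENNReal.ofReal ε) ∧
        (∀ n, meanM (ν n) = m)) := by
  have hs := fun m (hm : m ∈ ⋂ n : ℕ, Set.Icc (meanM (μ n) - ε) (meanM (μ n) + ε))
    (hΦ : ∀ N : ℕ, 1 ≤ N → ∀ x : ℕ → ℝ, PhiW μ m ε N x ≤ 0) => suff_dir hε hμ hm hΦ
  refine ⟨⟨?_, ?_⟩, hs⟩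
  · rintro ⟨ν, hν, hp, hw⟩
    exact nec_dir hε hμ hν hp hw
  · rintro ⟨m, hm, hΦ⟩
    obtain ⟨ν, h1, h2, h3, -⟩ := hs m hm hΦ
    exact ⟨ν, h1, h2, h3⟩
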